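/- With θ = π/30 and u = (2sinθ, 2sin2θ, 2sin3θ, 2sin4θ, 2sin5θ, sin2θ/sin3θ, sinθ/sin3θ, sinθ/sin2θ), one has the identity u_2·u_5·u_7·u_8 = u_1·u_3·u_4·u_6. -/

import Mathlib

open Real

/-- The Perron–Frobenius vector of the adjacency matrix of the E8 Dynkin
diagram, with `θ = π/30`. -/
noncomputable def E8u : Fin 8 → ℝ :=
  ![2 * Real.sin (π / 30), 2 * Real.sin (2 * (π / 30)), 2 * Real.sin (3 * (π / 30)),
    2 * Real.sin (4 * (π / 30)), 2 * Real.sin (5 * (π / 30)),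
    Real.sin (2 * (π / 30)) / Real.sin (3 * (π / 30)),
    Real.sin (π / 30) / Real.sin (3 * (π / 30)),
    Real.sin (π / 30) / Real.sin (2 * (π / 30))]

/-- Product-to-sum expansion of `4 sin 2x sin 3x sin 4x`. -/
lemma four_mul_sin_mul_sin_mul_sin (x : ℝ) :
    4 * sin (2 * x) * sin (3 * x) * sin (4 * x) =
      sin (5 * x) + sin x - 2 * sin (3 * x) * cos (6 * x) := by
  have h5 : 5 * x = 3 * x + 2 * x := by ring
  have h1 : sin x = sin (3 * x - 2 * x) := by ring_nf
  have h6 : 6 * x = 2 * x + 4 * x := by ring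
  have h2 : cos (2 * x) = cos (4 * x - 2 * x) := by ring_nf
  rw [h5, h1, h6, sin_add, sin_sub, cos_add]
  rw [cos_sub] at h2
  linear_combination -2 * sin (3 * x) * h2

lemma sin_three_mul_pi_div_thirty_mul_cos :
    2 * sin (3 * (π / 30)) * cos (6 * (π / 30)) = 1 / 2 := by
  have hs : sin (3 * (π / 30)) = cos (2 * (π / 5)) := by
    rw [← cos_pi_div_two_sub]
    ring_nf
  have hc : 6 * (π / 30) = π / 5 := by ring
  have h5 : √5 ^ 2 = (5 : ℝ) := sq_sqrt (by norm_num)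
  rw [hs, hc, cos_two_mul, cos_pi_div_five]
  linear_combination (1 / 16 * √5 + 3 / 16) * h5

lemma sin_five_mul_pi_div_thirty : sin (5 * (π / 30)) = 1 / 2 := by
  rw [show 5 * (π / 30) = π / 6 by ring, sin_pi_div_six]

/-- The identity `u₂·u₅·u₇·u₈ = u₁·u₃·u₄·u₆`. -/
theorem E8u_product_identity :
    E8u 1 * E8u 4 * E8u 6 * E8u 7 = E8u 0 * E8u 2 * E8u 3 * E8u 5 := by
  have h2 : 0 < sin (2 * (π / 30)) :=
    sin_pos_of_pos_of_lt_pi (by positivity) (by linarith [pi_pos])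
  have h3 : 0 < sin (3 * (π / 30)) :=
    sin_pos_of_pos_of_lt_pi (by positivity) (by linarith [pi_pos])
  have key : 4 * sin (2 * (π / 30)) * sin (3 * (π / 30)) * sin (4 * (π / 30)) = sin (π / 30) := by
    rw [four_mul_sin_mul_sin_mul_sin, sin_three_mul_pi_div_thirty_mul_cos,
      sin_five_mul_pi_div_thirty]
    ring
  change 2 * sin (2 * (π / 30)) * (2 * sin (5 * (π / 30))) *
      (sin (π / 30) / sin (3 * (π / 30))) * (sin (π / 30) / sin (2 * (π / 30))) =
    2 * sin (π / 30) * (2 * sin (3 * (π / 30))) * (2 * sin (4 * (π / 30))) *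
      (sin (2 * (π / 30)) / sin (3 * (π / 30)))
  rw [sin_five_mul_pi_div_thirty]
  generalize sin (2 * (π / 30)) = b at *
  generalize sin (3 * (π / 30)) = c at *
  generalize sin (4 * (π / 30)) = d at *
  generalize sin (π / 30) = a at *
  subst key
  field_simp
  ring
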